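/- arXiv:2602.23837 — 5 statements merged into one kernel-verified Lean document; each statement's English description precedes it below -/
import Mathlib

section
/- The stationary weight W satisfies the master (balance) equation of the m-NED: for every configuration β ∈ Ω, ∑_{α ∈ Ω} P(α → β) · W(α) = W(β). Consequently π = W/Z_{n,m} is the unique stationary distribution of the m-NED Markov chain. -/
open Finset

/-- Per-site transition factor `q_i(α, b)` of the m-NED: if the window
`(α_i, …, α_{i+m-1})` is `0^m` the site becomes `1` with probability `p1`;
if it is `0^{m-1}1` it becomes `1` with probability `1 - p2`; otherwise it
becomes `0` with probability `1`. -/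
noncomputable def nedQ (n m : ℕ) (p1 p2 : ℝ) (α : ZMod n → Bool) (i : ZMod n) (b : Bool) : ℝ :=
  if ∀ j : Fin m, α (i + (j.val : ZMod n)) = false then
    if b then p1 else 1 - p1
  else if (∀ j : Fin (m - 1), α (i + (j.val : ZMod n)) = false) ∧
      α (i + ((m - 1 : ℕ) : ZMod n)) = true then
    if b then 1 - p2 else p2
  else if b then 0 else 1

/-- Transition probability `P(α → β)` of the m-NED on the ring of `n` sites. -/
noncomputable def nedP (n m : ℕ) [NeZero n] (p1 p2 : ℝ) (α β : ZMod n → Bool) : ℝ :=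
  ∏ i : ZMod n, nedQ n m p1 p2 α i (β i)

/-- `N₁(β)`: the number of sites carrying the symbol `1`. -/
def nedN1 (n : ℕ) [NeZero n] (β : ZMod n → Bool) : ℕ :=
  (univ.filter fun i : ZMod n => β i = true).card

/-- `N_{10^r 1}(β)`: the number of occurrences of the subsequence `1 0^r 1`. -/
def nedN10r1 (n : ℕ) [NeZero n] (r : ℕ) (β : ZMod n → Bool) : ℕ :=
  (univ.filter fun i : ZMod n =>
    β i = true ∧ (∀ j : Fin r, β (i + ((j.val + 1 : ℕ) : ZMod n)) = false) ∧
      β (i + ((r + 1 : ℕ) : ZMod n)) = true).card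

/-- `N_{0^r 1}(β)`: the number of occurrences of the subsequence `0^r 1`. -/
def nedN0r1 (n : ℕ) [NeZero n] (r : ℕ) (β : ZMod n → Bool) : ℕ :=
  (univ.filter fun i : ZMod n =>
    (∀ j : Fin r, β (i + (j.val : ZMod n)) = false) ∧
      β (i + ((r : ℕ) : ZMod n)) = true).card

/-- The stationary weight
`W(β) = p1^{N₁(β)} (1-p1)^{∑_{r=1}^{m-2} r N_{10^r1}(β) + (m-1) N_{0^{m-1}1}(β)} p2^{-N_{0^{m-1}1}(β)}`. -/
noncomputable def nedW (n m : ℕ) [NeZero n] (p1 p2 : ℝ) (β : ZMod n → Bool) : ℝ :=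
  p1 ^ nedN1 n β *
    (1 - p1) ^ ((∑ r ∈ Finset.Icc 1 (m - 2), r * nedN10r1 n r β) +
      (m - 1) * nedN0r1 n (m - 1) β) / p2 ^ nedN0r1 n (m - 1) β

/-- The partition function `Z_{n,m} = ∑_{β ∈ Ω} W(β)`. -/
noncomputable def nedZ (n m : ℕ) [NeZero n] (p1 p2 : ℝ) : ℝ :=
  ∑ β : ZMod n → Bool, nedW n m p1 p2 β

/-- Integer binomial coefficient with the convention `C(-1,-1) = 1`
(and value `0` when the lower index is otherwise negative). -/
def ichoose (a b : ℤ) : ℕ :=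
  if a = -1 ∧ b = -1 then 1 else if 0 ≤ b then Nat.choose a.toNat b.toNat else 0

/-- The multinomial coefficient `k! / (x₁! ⋯ x_t! · N! · (k - N - ∑ x)!)`, written as the
product of successive binomial coefficients (hence `0` whenever `N + ∑ x > k`). -/
def multChain {t : ℕ} (k : ℕ) (x : Fin t → ℕ) (N : ℕ) : ℕ :=
  (∏ j : Fin t, Nat.choose (k - ∑ s ∈ univ.filter (fun s => s < j), x s) (x j)) *
    Nat.choose (k - ∑ s, x s) N

/-- `𝒯_M`: the tuples `(x_1, …, x_{m-2}) ∈ {0,1,…,k}^{m-2}` with `∑_{s=1}^{m-2} s·x_s = M`. -/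
def nedT (m k M : ℕ) : Finset (Fin (m - 2) → ℕ) :=
  (Fintype.piFinset fun _ : Fin (m - 2) => Finset.range (k + 1)).filter fun x =>
    ∑ s, (s.val + 1) * x s = M

/-- `𝒞_{n,k}`: the pairs `(M, N)` of nonnegative integers with
`M ∈ {0,…,n-k-m+1} ∪ {n-k}`, `(m-1)·N + M ≤ n-k`, and `N = 0 ↔ M = n-k`. -/
def nedC (n m k : ℕ) : Finset (ℕ × ℕ) :=
  (Finset.range (n + 1) ×ˢ Finset.range (n + 1)).filter fun MN =>
    (MN.1 + (m - 1) ≤ n - k ∨ MN.1 = n - k) ∧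
      MN.2 * (m - 1) + MN.1 ≤ n - k ∧ (MN.2 = 0 ↔ MN.1 = n - k)

/-- `|Pos_{a₁b₁,a₂b₂}|`: the number of sites `i` with `(α_i, α_{i+1}) = (a₁, b₁)` and
`(β_i, β_{i+1}) = (a₂, b₂)`. -/
def posCount (n : ℕ) [NeZero n] (α β : ZMod n → Bool) (a1 b1 a2 b2 : Bool) : ℕ :=
  (univ.filter fun i : ZMod n =>
    α i = a1 ∧ α (i + 1) = b1 ∧ β i = a2 ∧ β (i + 1) = b2).card

/-- The explicit sequence `Z_0 = 2`,
`Z_n = 1 + ∑_{k=1}^n ∑_{j=0}^{n-k} (n/k)·C(k,j)·C(n-k-1,j-1)·p1^k·q2^j` for `n ≥ 1`,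
with `q2 = (1-p1)/p2` and the convention `C(-1,-1) = 1`. -/
noncomputable def Zseq (p1 p2 : ℝ) (n : ℕ) : ℝ :=
  if n = 0 then 2
  else 1 + ∑ k ∈ Finset.Icc 1 n, ∑ j ∈ Finset.range (n - k + 1),
    (n : ℝ) / k * (Nat.choose k j : ℝ) * (ichoose ((n : ℤ) - k - 1) ((j : ℤ) - 1) : ℝ) *
      p1 ^ k * ((1 - p1) / p2) ^ j

/-- The unnormalized density sequence `D_0 = 0`,
`D_n = ∑_{k=1}^n ∑_{j=0}^{n-k} C(k,j)·C(n-k-1,j-1)·p1^k·q2^j` for `n ≥ 1`. -/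
noncomputable def Dseq (p1 p2 : ℝ) (n : ℕ) : ℝ :=
  if n = 0 then 0
  else ∑ k ∈ Finset.Icc 1 n, ∑ j ∈ Finset.range (n - k + 1),
    (Nat.choose k j : ℝ) * (ichoose ((n : ℤ) - k - 1) ((j : ℤ) - 1) : ℝ) *
      p1 ^ k * ((1 - p1) / p2) ^ j

/-- The partition function of the 2-NED on a ring of `n ≥ 1` sites,
`Z_{n,2} = ∑_{β ∈ Ω} p1^{N₁(β)} ((1-p1)/p2)^{N_{01}(β)}` (with value `2` at `n = 0`). -/
noncomputable def Zpart2 (p1 p2 : ℝ) (n : ℕ) : ℝ :=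
  if h : n = 0 then 2
  else
    haveI : NeZero n := ⟨h⟩
    ∑ β : ZMod n → Bool, p1 ^ nedN1 n β * ((1 - p1) / p2) ^ nedN0r1 n 1 β
/-- The predicate that `β` vanishes on the `k` consecutive sites `i, …, i + k - 1`. -/
def ZeroRun {n : ℕ} (β : ZMod n → Bool) (k : ℕ) (i : ZMod n) : Prop :=
  ∀ j < k, β (i + (j : ZMod n)) = false

instance {n : ℕ} (β : ZMod n → Bool) (k : ℕ) : DecidablePred (ZeroRun β k) :=
  fun _ => by unfold ZeroRun; infer_instance

/-- The number of sites at which a run of at least `k` zeros starts. -/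
def zeroRunCount (n : ℕ) [NeZero n] (k : ℕ) (β : ZMod n → Bool) : ℕ :=
  (univ.filter (ZeroRun β k)).card

theorem zeroRun_succ {n : ℕ} (β : ZMod n → Bool) (k : ℕ) (i : ZMod n) :
    ZeroRun β (k + 1) i ↔ ZeroRun β k i ∧ β (i + (k : ZMod n)) = false := by
  unfold ZeroRun
  rw [Nat.forall_lt_succ_right]

theorem zeroRun_succ' {n : ℕ} (β : ZMod n → Bool) (k : ℕ) (i : ZMod n) :
    ZeroRun β (k + 1) i ↔ β i = false ∧ ZeroRun β k (i + 1) := by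
  unfold ZeroRun
  rw [Nat.forall_lt_succ_left]
  simp [add_right_comm i _ 1, ← add_assoc]

theorem zeroRun_one {n : ℕ} (β : ZMod n → Bool) (i : ZMod n) :
    ZeroRun β 1 i ↔ β i = false := by
  simp [ZeroRun]

theorem card_filter_add_right {n : ℕ} [NeZero n] (p : ZMod n → Prop) [DecidablePred p]
    (c : ZMod n) : (univ.filter fun i => p (i + c)).card = (univ.filter p).card := by
  simp only [card_filter]
  exact Equiv.sum_comp (Equiv.addRight c) fun i => if p i then 1 else 0

theorem nedN0r1_eq {n : ℕ} [NeZero n] (k : ℕ) (β : ZMod n → Bool) :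
    nedN0r1 n k β =
      (univ.filter fun i : ZMod n => ZeroRun β k i ∧ β (i + (k : ZMod n)) = true).card := by
  unfold nedN0r1
  congr 1
  ext i
  rw [mem_filter, mem_filter]
  simp [ZeroRun, Fin.forall_iff]

theorem card_filter_and_add_card_filter_and_not {α : Type*} [Fintype α] (p q : α → Prop)
    [DecidablePred p] [DecidablePred q] :
    (univ.filter fun a => p a ∧ q a).card + (univ.filter fun a => p a ∧ ¬ q a).card =
      (univ.filter p).card := by
  rw [← filter_filter, ← filter_filter]
  exact card_filter_add_card_filter_not q

theorem nedN0r1_add_zeroRunCount {n : ℕ} [NeZero n] (k : ℕ) (β : ZMod n → Bool) :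
    nedN0r1 n k β + zeroRunCount n (k + 1) β = zeroRunCount n k β := by
  rw [nedN0r1_eq, zeroRunCount, zeroRunCount, ← card_filter_and_add_card_filter_and_not
    (ZeroRun β k) fun i => β (i + (k : ZMod n)) = true]
  simp [zeroRun_succ]

/-- By rotation invariance, the patterns `1 0^k` and `0^k 1` are equally frequent. -/
theorem card_one_zeroRun {n : ℕ} [NeZero n] (k : ℕ) (β : ZMod n → Bool) :
    (univ.filter fun i : ZMod n => β i = true ∧ ZeroRun β k (i + 1)).card = nedN0r1 n k β := by
  have h := card_filter_and_add_card_filter_and_not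
    (fun i => ZeroRun β k (i + 1)) fun i => β i = true
  rw [card_filter_add_right (ZeroRun β k) 1] at h
  have h' := nedN0r1_add_zeroRunCount k β
  simp only [zeroRunCount, zeroRun_succ'] at h'
  simp only [Bool.not_eq_true, and_comm] at h h' ⊢
  omega

theorem nedN10r1_add_nedN0r1 {n : ℕ} [NeZero n] (r : ℕ) (β : ZMod n → Bool) :
    nedN10r1 n r β + nedN0r1 n (r + 1) β = nedN0r1 n r β := by
  have h := card_filter_and_add_card_filter_and_not
    (fun i => ZeroRun β r (i + 1) ∧ β (i + 1 + (r : ZMod n)) = true) fun i => β i = true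
  rw [card_filter_add_right (fun i => ZeroRun β r i ∧ β (i + (r : ZMod n)) = true) 1] at h
  rw [nedN0r1_eq r, ← h, nedN0r1_eq, nedN10r1]
  congr 2
  · ext i
    rw [mem_filter, mem_filter]
    simp only [ZeroRun, Fin.forall_iff, Nat.cast_add, Nat.cast_one, ← add_assoc,
      add_right_comm i _ 1, mem_univ, true_and]
    tauto
  · ext i
    simp only [mem_filter, zeroRun_succ', Nat.cast_add, Nat.cast_one, ← add_assoc,
      add_right_comm i _ 1, mem_univ, true_and, Bool.not_eq_true]
    tauto

theorem sum_nedN10r1_add {n : ℕ} [NeZero n] (k : ℕ) (β : ZMod n → Bool) :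
    ∑ r ∈ Icc 1 k, r * nedN10r1 n r β + (k + 1) * nedN0r1 n (k + 1) β +
      zeroRunCount n (k + 2) β = zeroRunCount n 1 β := by
  induction k with
  | zero => simpa using nedN0r1_add_zeroRunCount 1 β
  | succ k ih =>
    rw [← ih, sum_Icc_succ_top (by omega), ← nedN10r1_add_nedN0r1 (k + 1),
      ← nedN0r1_add_zeroRunCount (k + 2)]
    ring

/-- The exponent of `1 - p1` counts the zeros followed by a `1` within distance `k + 1`. -/
theorem sum_nedN10r1_eq_card {n : ℕ} [NeZero n] (k : ℕ) (β : ZMod n → Bool) :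
    ∑ r ∈ Icc 1 k, r * nedN10r1 n r β + (k + 1) * nedN0r1 n (k + 1) β =
      (univ.filter fun i : ZMod n => β i = false ∧ ¬ ZeroRun β (k + 2) i).card := by
  have h := sum_nedN10r1_add k β
  have h' := card_filter_and_add_card_filter_and_not (fun i => β i = false) (ZeroRun β (k + 2))
  have e : (univ.filter fun i => β i = false ∧ ZeroRun β (k + 2) i) =
      univ.filter (ZeroRun β (k + 2)) := by
    ext i
    simp +contextual [zeroRun_succ' β (k + 1)]
  rw [e] at h'
  simp only [zeroRunCount, zeroRun_one] at h
  omega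

/-- The mirror image of `sum_nedN10r1_eq_card`. -/
theorem sum_nedN10r1_eq_card' {n : ℕ} [NeZero n] (k : ℕ) (β : ZMod n → Bool) :
    ∑ r ∈ Icc 1 k, r * nedN10r1 n r β + (k + 1) * nedN0r1 n (k + 1) β =
      (univ.filter fun i : ZMod n =>
        β (i + ((k + 1 : ℕ) : ZMod n)) = false ∧ ¬ ZeroRun β (k + 2) i).card := by
  have h := sum_nedN10r1_add k β
  have h' := card_filter_and_add_card_filter_and_not
    (fun i => β (i + ((k + 1 : ℕ) : ZMod n)) = false) (ZeroRun β (k + 2))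
  have e : (univ.filter fun i => β (i + ((k + 1 : ℕ) : ZMod n)) = false ∧ ZeroRun β (k + 2) i) =
      univ.filter (ZeroRun β (k + 2)) := by
    ext i
    simp +contextual [zeroRun_succ β (k + 1)]
  rw [e, card_filter_add_right (fun i => β i = false)] at h'
  simp only [zeroRunCount, zeroRun_one] at h
  omega

theorem prod_ite_one_eq_pow {α : Type*} [Fintype α] (p : α → Prop) [DecidablePred p] (x : ℝ) :
    ∏ a, (if p a then x else 1) = x ^ (univ.filter p).card := by
  rw [prod_ite]
  simp

theorem nedW_eq_prod (n k : ℕ) [NeZero n] (p1 p2 : ℝ) (β : ZMod n → Bool) :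
    nedW n (k + 2) p1 p2 β = ∏ i, ((if β i = true then p1 else 1) *
      (if β i = false ∧ ¬ ZeroRun β (k + 2) i then 1 - p1 else 1) *
      (if ZeroRun β (k + 1) i ∧ β (i + ((k + 1 : ℕ) : ZMod n)) = true then p2⁻¹ else 1)) := by
  simp only [prod_mul_distrib, prod_ite_one_eq_pow]
  rw [← sum_nedN10r1_eq_card, ← nedN0r1_eq, nedW, nedN1, inv_pow, div_eq_mul_inv]
  rfl

theorem nedW_eq_prod' (n k : ℕ) [NeZero n] (p1 p2 : ℝ) (β : ZMod n → Bool) :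
    nedW n (k + 2) p1 p2 β = ∏ i, ((if β i = true then p1 else 1) *
      (if β (i + ((k + 1 : ℕ) : ZMod n)) = false ∧ ¬ ZeroRun β (k + 2) i then 1 - p1 else 1) *
      (if β i = true ∧ ZeroRun β (k + 1) (i + 1) then p2⁻¹ else 1)) := by
  simp only [prod_mul_distrib, prod_ite_one_eq_pow]
  rw [← sum_nedN10r1_eq_card', card_one_zeroRun, nedW, nedN1, inv_pow, div_eq_mul_inv]
  rfl

theorem nedQ_eq (n k : ℕ) (p1 p2 : ℝ) (α : ZMod n → Bool) (i : ZMod n) (b : Bool) :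
    nedQ n (k + 2) p1 p2 α i b =
      if ZeroRun α (k + 2) i then if b then p1 else 1 - p1
      else if ZeroRun α (k + 1) i ∧ α (i + ((k + 1 : ℕ) : ZMod n)) = true then
        if b then 1 - p2 else p2
      else if b then 0 else 1 := by
  simp [nedQ, ZeroRun, Fin.forall_iff]

/-- Site factor of `P(α → β) W(α)`, once the constraint that `α` vanishes on the `k + 1` sites
to the right of every `1` of `β` is taken into account. -/
noncomputable def nedSite {n : ℕ} (k : ℕ) (p1 p2 : ℝ) (β : ZMod n → Bool) (j : ZMod n)
    (a : Bool) : ℝ :=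
  (if ZeroRun β (k + 1) (j + 1) then 1 else if a then 0 else 1) *
    (if β (j + ((k + 1 : ℕ) : ZMod n)) then 1 else if a then p1 else 1 - p1) *
    (if β j then if a then (1 - p2) * (1 - p1) / p2 else p1 else 1)

theorem sum_nedSite {n : ℕ} (k : ℕ) {p1 p2 : ℝ} (hp2 : p2 ≠ 0) (β : ZMod n → Bool)
    (j : ZMod n) :
    ∑ a, nedSite k p1 p2 β j a = (if β j = true then p1 else 1) *
      (if β (j + ((k + 1 : ℕ) : ZMod n)) = false ∧ ¬ ZeroRun β (k + 2) j then 1 - p1 else 1) *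
      (if β j = true ∧ ZeroRun β (k + 1) (j + 1) then p2⁻¹ else 1) := by
  have h : ZeroRun β (k + 1) (j + 1) → β (j + ((k + 1 : ℕ) : ZMod n)) = false := by
    rw [zeroRun_succ]
    intro h
    rw [← h.2]
    push_cast
    ring_nf
  have h' := zeroRun_succ' β (k + 1) j
  rw [Fintype.sum_bool]
  unfold nedSite
  generalize ((k + 1 : ℕ) : ZMod n) = c at h ⊢
  by_cases h1 : ZeroRun β (k + 1) (j + 1)
  · have h2 := h h1
    cases h3 : β j <;> simp [h1, h2, h3, h']
    field_simp
    ring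
  · cases h3 : β j <;> cases h4 : β (j + c) <;> simp [h1, h3, h', mul_comm]

/-- The joint weight of a transition factorizes over the sites of its source. -/
theorem nedP_mul_nedW (n k : ℕ) [NeZero n] {p1 p2 : ℝ} (hp2 : p2 ≠ 0) (α β : ZMod n → Bool) :
    nedP n (k + 2) p1 p2 α β * nedW n (k + 2) p1 p2 α =
      ∏ j, nedSite k p1 p2 β j (α (j + ((k + 1 : ℕ) : ZMod n))) := by
  rw [nedW_eq_prod, nedP, ← prod_mul_distrib]
  by_cases hC : ∀ i, β i = true → ZeroRun α (k + 1) i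
  · have hR : ∀ j, nedSite k p1 p2 β j (α (j + ((k + 1 : ℕ) : ZMod n))) =
        (fun j => if β j then 1 else if α j then p1 else 1 - p1) (j + ((k + 1 : ℕ) : ZMod n)) *
        (if β j then if α (j + ((k + 1 : ℕ) : ZMod n)) then (1 - p2) * (1 - p1) / p2 else p1
          else 1) := by
      intro j
      have h : ¬ ZeroRun β (k + 1) (j + 1) → α (j + ((k + 1 : ℕ) : ZMod n)) = false := by
        unfold ZeroRun
        push Not
        rintro ⟨t, ht, hβ⟩
        have := hC _ (by simpa using hβ) (k - t) (by omega)
        rw [← this]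
        congr 1
        rw [Nat.cast_sub (by omega)]
        push_cast
        ring
      unfold nedSite
      by_cases hz : ZeroRun β (k + 1) (j + 1)
      · simp only [hz, if_true, one_mul]
      · simp only [hz, h hz, if_false, one_mul, Bool.false_eq_true]
    have hshift := Equiv.prod_comp (Equiv.addRight ((k + 1 : ℕ) : ZMod n))
      fun j => if β j then (1 : ℝ) else if α j then p1 else 1 - p1
    rw [prod_congr rfl fun j _ => hR j]
    refine Eq.trans ?_ (prod_mul_distrib.trans (congrArg₂ (· * ·) hshift rfl)).symm
    rw [← prod_mul_distrib]
    refine prod_congr rfl fun i _ => ?_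
    have h0 : ZeroRun α (k + 1) i → α i = false := fun h => ((zeroRun_succ' α k i).1 h).1
    have h1 := hC i
    have h2 := zeroRun_succ α (k + 1) i
    rw [nedQ_eq]
    generalize ((k + 1 : ℕ) : ZMod n) = c at h2 ⊢
    by_cases hz : ZeroRun α (k + 1) i
    · cases hβ : β i <;> cases hc : α (i + c) <;> simp [hz, hc, h2, h0 hz]
      · field_simp
      · field_simp
    · have hβ : β i = false := by simpa using mt h1 hz
      cases hα : α i <;> simp [hz, h2, hβ]
  · push Not at hC
    obtain ⟨i, hi, hz⟩ := hC
    rw [prod_eq_zero (mem_univ i), eq_comm]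
    · unfold ZeroRun at hz
      push Not at hz
      obtain ⟨t, ht, hα⟩ := hz
      refine prod_eq_zero (mem_univ (i + (t : ZMod n) - ((k + 1 : ℕ) : ZMod n))) ?_
      have : ¬ ZeroRun β (k + 1) (i + (t : ZMod n) - ((k + 1 : ℕ) : ZMod n) + 1) := by
        intro h
        have := h (k - t) (by omega)
        rw [Nat.cast_sub (by omega)] at this
        push_cast at this
        ring_nf at this
        simp [hi] at this
      unfold nedSite
      rw [sub_add_cancel, if_neg this, if_pos (by simpa using hα), zero_mul, zero_mul]
    · have hz' : ¬ ZeroRun α (k + 2) i := fun h => hz ((zeroRun_succ α (k + 1) i).1 h).1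
      rw [nedQ_eq]
      simp [hz, hz', hi]

theorem ned_balance (n k : ℕ) [NeZero n] {p1 p2 : ℝ} (hp2 : p2 ≠ 0) (β : ZMod n → Bool) :
    ∑ α, nedP n (k + 2) p1 p2 α β * nedW n (k + 2) p1 p2 α = nedW n (k + 2) p1 p2 β := by
  simp only [nedP_mul_nedW n k hp2]
  refine (Equiv.sum_comp
    (Equiv.arrowCongr (Equiv.addRight ((k + 1 : ℕ) : ZMod n)).symm (Equiv.refl Bool))
    fun α => ∏ j, nedSite k p1 p2 β j (α j)).trans ?_
  rw [← Fintype.piFinset_univ, ← prod_univ_sum, nedW_eq_prod']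
  exact prod_congr rfl fun j _ => sum_nedSite k hp2 β j

theorem sum_nedQ (n m : ℕ) (p1 p2 : ℝ) (α : ZMod n → Bool) (i : ZMod n) :
    ∑ b, nedQ n m p1 p2 α i b = 1 := by
  unfold nedQ
  split_ifs <;> simp

theorem sum_nedP (n m : ℕ) [NeZero n] (p1 p2 : ℝ) (α : ZMod n → Bool) :
    ∑ β, nedP n m p1 p2 α β = 1 := by
  unfold nedP
  rw [← Fintype.piFinset_univ, ← prod_univ_sum]
  simp only [sum_nedQ, prod_const_one]

theorem nedQ_nonneg {n m : ℕ} {p1 p2 : ℝ} (hp1 : p1 ∈ Set.Ioo (0 : ℝ) 1)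
    (hp2 : p2 ∈ Set.Ioc (0 : ℝ) 1) (α : ZMod n → Bool) (i : ZMod n) (b : Bool) :
    0 ≤ nedQ n m p1 p2 α i b := by
  obtain ⟨h1, h2⟩ := hp1
  obtain ⟨h3, h4⟩ := hp2
  unfold nedQ
  split_ifs <;> linarith

theorem nedQ_false_pos {n m : ℕ} {p1 p2 : ℝ} (hp1 : p1 ∈ Set.Ioo (0 : ℝ) 1)
    (hp2 : p2 ∈ Set.Ioc (0 : ℝ) 1) (α : ZMod n → Bool) (i : ZMod n) :
    0 < nedQ n m p1 p2 α i false := by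
  obtain ⟨h1, h2⟩ := hp1
  obtain ⟨h3, h4⟩ := hp2
  unfold nedQ
  split_ifs <;> simp_all

theorem nedW_pos {n m : ℕ} [NeZero n] {p1 p2 : ℝ} (hp1 : p1 ∈ Set.Ioo (0 : ℝ) 1)
    (hp2 : p2 ∈ Set.Ioc (0 : ℝ) 1) (β : ZMod n → Bool) : 0 < nedW n m p1 p2 β := by
  have h1 := hp1.1
  have h2 := sub_pos.2 hp1.2
  have h3 := hp2.1
  unfold nedW
  positivity

/-- A signed invariant vector of total mass zero vanishes if some state is reached in one step
from everywhere (Doeblin's condition). -/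
theorem eq_zero_of_invariant_of_sum_eq_zero {S : Type*} [Fintype S] [DecidableEq S]
    {P : S → S → ℝ} (hP : ∀ a b, 0 ≤ P a b) (hsum : ∀ a, ∑ b, P a b = 1) (s : S)
    (hs : ∀ a, 0 < P a s) {v : S → ℝ} (hv : ∑ a, v a = 0)
    (hinv : ∀ b, ∑ a, P a b * v a = v b) : v = 0 := by
  have : Nonempty S := ⟨s⟩
  obtain ⟨a₀, ha₀⟩ := Finite.exists_min fun a => P a s
  set c := P a₀ s
  let R : S → S → ℝ := fun a b => P a b - if b = s then c else 0
  have hR : ∀ a b, 0 ≤ R a b := by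
    intro a b
    simp only [R]
    split_ifs with h
    · rw [h]
      exact sub_nonneg.2 (ha₀ a)
    · simpa using hP a b
  have hRsum : ∀ a, ∑ b, R a b = 1 - c := by
    intro a
    simp [R, sum_sub_distrib, hsum]
  have hRv : ∀ b, ∑ a, R a b * v a = v b := by
    intro b
    simp only [R, sub_mul, sum_sub_distrib, hinv, ← mul_sum, hv, mul_zero, sub_zero]
  have hle : ∑ b, |v b| ≤ (1 - c) * ∑ a, |v a| := calc
    ∑ b, |v b| = ∑ b, |∑ a, R a b * v a| := by simp only [hRv]
    _ ≤ ∑ b, ∑ a, R a b * |v a| := by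
      refine sum_le_sum fun b _ => (abs_sum_le_sum_abs _ _).trans_eq ?_
      simp only [abs_mul, abs_of_nonneg (hR _ _)]
    _ = (1 - c) * ∑ a, |v a| := by
      rw [sum_comm, mul_sum]
      simp only [← sum_mul, hRsum]
  have hnonneg : 0 ≤ ∑ a, |v a| := sum_nonneg fun a _ => abs_nonneg _
  have hzero : ∑ a, |v a| = 0 := by nlinarith [hs a₀]
  ext a
  exact abs_eq_zero.1 ((sum_eq_zero_iff_of_nonneg fun a _ => abs_nonneg _).1 hzero a (mem_univ a))

/-- the stationary weight satisfies the master (balance) equation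
`∑_α P(α → β) W(α) = W(β)`, and consequently `π = W / Z_{n,m}` is the unique
stationary distribution of the m-NED Markov chain. -/
theorem ned_master_equation (n m : ℕ) [NeZero n] (hm : 2 ≤ m) (hmn : m ≤ n)
    (p1 p2 : ℝ) (hp1 : p1 ∈ Set.Ioo (0 : ℝ) 1) (hp2 : p2 ∈ Set.Ioc (0 : ℝ) 1) :
    (∀ β : ZMod n → Bool,
        ∑ α : ZMod n → Bool, nedP n m p1 p2 α β * nedW n m p1 p2 α = nedW n m p1 p2 β) ∧
      ∀ μ : (ZMod n → Bool) → ℝ, (∀ α, 0 ≤ μ α) → (∑ α : ZMod n → Bool, μ α) = 1 →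
        (∀ β : ZMod n → Bool, ∑ α : ZMod n → Bool, nedP n m p1 p2 α β * μ α = μ β) →
        μ = fun β => nedW n m p1 p2 β / nedZ n m p1 p2 := by
  obtain ⟨k, rfl⟩ : ∃ k, m = k + 2 := ⟨m - 2, by omega⟩
  have hbal := ned_balance n k (p1 := p1) hp2.1.ne'
  refine ⟨hbal, fun μ _ hμ1 hμ => ?_⟩
  have hZ : nedZ n (k + 2) p1 p2 ≠ 0 :=
    (sum_pos (fun β _ => nedW_pos hp1 hp2 β) univ_nonempty).ne'
  rw [← sub_eq_zero]
  refine eq_zero_of_invariant_of_sum_eq_zero (P := nedP n (k + 2) p1 p2)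
    (fun α β => prod_nonneg fun i _ => nedQ_nonneg hp1 hp2 α i (β i)) (sum_nedP n (k + 2) p1 p2)
    (fun _ => false) (fun α => prod_pos fun i _ => nedQ_false_pos hp1 hp2 α i) ?_ fun β => ?_
  · simp only [Pi.sub_apply, sum_sub_distrib, hμ1, ← sum_div]
    rw [← nedZ, div_self hZ, sub_self]
  · simp only [Pi.sub_apply, mul_sub, sum_sub_distrib, hμ, ← mul_div_assoc, ← sum_div, hbal]
end

section
/- For neighbourhood size m = 2 and p1, p2 ∈ (0,1), the 2-NED Markov chain is reversible — i.e. the detailed balance condition π(α)·P(α → β) = π(β)·P(β → α) holds for all configurations α, β ∈ Ω — if and only if n = 2, or n > 2 and p1 + p2 = 1. -/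
open Finset

theorem nedQ_two (n : ℕ) (p1 p2 : ℝ) (α : ZMod n → Bool) (i : ZMod n) (b : Bool) :
    nedQ n 2 p1 p2 α i b =
      if α i = false then
        if α (i + 1) = false then (if b then p1 else 1 - p1) else (if b then 1 - p2 else p2)
      else if b then 0 else 1 := by
  unfold nedQ
  cases h : α i <;> cases h' : α (i + 1) <;> simp [Fin.forall_fin_two, h, h']

theorem nedN0r1_one (n : ℕ) [NeZero n] (α : ZMod n → Bool) :
    nedN0r1 n 1 α = (univ.filter fun i : ZMod n => α i = false ∧ α (i + 1) = true).card := by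
  simp [nedN0r1]

theorem nedW_two (n : ℕ) [NeZero n] (p1 p2 : ℝ) (α : ZMod n → Bool) :
    nedW n 2 p1 p2 α =
      p1 ^ nedN1 n α * (1 - p1) ^ nedN0r1 n 1 α / p2 ^ nedN0r1 n 1 α := by
  simp [nedW]

theorem nedW_two_pos (n : ℕ) [NeZero n] {p1 p2 : ℝ} (hp1 : p1 ∈ Set.Ioo (0 : ℝ) 1)
    (hp2 : p2 ∈ Set.Ioo (0 : ℝ) 1) (α : ZMod n → Bool) : 0 < nedW n 2 p1 p2 α := by
  have := hp1.1
  have := hp2.1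
  have := sub_pos.2 hp1.2
  rw [nedW_two]
  positivity

theorem nedZ_two_pos (n : ℕ) [NeZero n] {p1 p2 : ℝ} (hp1 : p1 ∈ Set.Ioo (0 : ℝ) 1)
    (hp2 : p2 ∈ Set.Ioo (0 : ℝ) 1) : 0 < nedZ n 2 p1 p2 :=
  sum_pos (fun α _ => nedW_two_pos n hp1 hp2 α) univ_nonempty

/-- On a ring of two sites, the weights satisfy detailed balance. -/
theorem nedW_mul_nedP_two_sites {p1 p2 : ℝ} (hp2 : p2 ≠ 0) (α β : ZMod 2 → Bool) :
    nedW 2 2 p1 p2 α * nedP 2 2 p1 p2 α β = nedW 2 2 p1 p2 β * nedP 2 2 p1 p2 β α := by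
  have hprod (f : ZMod 2 → ℝ) : ∏ i, f i = f 0 * f 1 := Fin.prod_univ_two f
  have hsum (f : ZMod 2 → ℕ) : ∑ i, f i = f 0 + f 1 := Fin.sum_univ_two f
  have h11 : (1 + 1 : ZMod 2) = 0 := rfl
  simp only [nedW_two, nedP, nedN0r1_one, nedN1, card_filter, hprod, hsum, nedQ_two, h11, zero_add]
  cases α 0 <;> cases α 1 <;> cases β 0 <;> cases β 1 <;> simp <;> field_simp

/-- When `p1 + p2 = 1`, the weight is a product of single-site weights. -/
theorem nedW_two_eq_prod (n : ℕ) [NeZero n] {p1 p2 : ℝ} (hp2 : p2 ≠ 0) (h : p1 + p2 = 1)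
    (α : ZMod n → Bool) : nedW n 2 p1 p2 α = ∏ i, if α i = true then p1 else 1 := by
  obtain rfl : p2 = 1 - p1 := by linarith
  rw [nedW_two, mul_div_assoc, div_self (pow_ne_zero _ hp2), mul_one, nedN1, prod_ite]
  simp

theorem nedW_mul_nedP_of_add_eq_one (n : ℕ) [NeZero n] {p1 p2 : ℝ} (hp2 : p2 ≠ 0)
    (h : p1 + p2 = 1) (α β : ZMod n → Bool) :
    nedW n 2 p1 p2 α * nedP n 2 p1 p2 α β = nedW n 2 p1 p2 β * nedP n 2 p1 p2 β α := by
  rw [nedW_two_eq_prod n hp2 h, nedW_two_eq_prod n hp2 h, nedP, nedP, ← prod_mul_distrib,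
    ← prod_mul_distrib]
  obtain rfl : p2 = 1 - p1 := by linarith
  refine prod_congr rfl fun i _ => ?_
  rw [nedQ_two, nedQ_two]
  cases α i <;> cases β i <;> simp

/-- The weight of a configuration with a single `1` does not depend on its site. -/
theorem nedW_two_single (n : ℕ) [NeZero n] (hn : 2 ≤ n) (p1 p2 : ℝ) (c : ZMod n) :
    nedW n 2 p1 p2 (fun i => decide (i = c)) = p1 * (1 - p1) / p2 := by
  have : Fact (1 < n) := ⟨hn⟩
  have h1 : nedN1 n (fun i => decide (i = c)) = 1 := by
    simp [nedN1, filter_eq']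
  have h2 : nedN0r1 n 1 (fun i => decide (i = c)) = 1 := by
    rw [nedN0r1_one, card_eq_one]
    refine ⟨c - 1, ?_⟩
    ext i
    simp only [mem_filter, mem_univ, true_and, decide_eq_false_iff_not, decide_eq_true_eq,
      mem_singleton, eq_sub_iff_add_eq, and_iff_right_iff_imp]
    rintro rfl h
    simp at h
  rw [nedW_two, h1, h2]
  simp

/-- Detailed balance between the configurations with a single `1` at sites `0` and `1`
forces `p1 + p2 = 1`. -/
theorem add_eq_one_of_nedP_single (n : ℕ) [NeZero n] (hn : 2 < n) {p1 p2 : ℝ} (hp1 : p1 < 1)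
    (h : nedP n 2 p1 p2 (fun i => decide (i = 0)) (fun i => decide (i = 1)) =
      nedP n 2 p1 p2 (fun i => decide (i = 1)) (fun i => decide (i = 0))) :
    p1 + p2 = 1 := by
  have : Fact (1 < n) := ⟨by omega⟩
  have h10 : (1 : ZMod n) ≠ 0 := one_ne_zero
  have h20 : (1 + 1 : ZMod n) ≠ 0 := by
    intro h
    have h2 : ((2 : ℕ) : ZMod n) = 0 := by
      push_cast
      rw [← one_add_one_eq_two, h]
    exact absurd (Nat.le_of_dvd two_pos ((ZMod.natCast_eq_zero_iff 2 n).1 h2)) (by omega)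
  have hm1 : (-1 : ZMod n) ≠ 1 := fun h => h20 (by nth_rewrite 1 [← h]; simp)
  have hm0 : (-1 : ZMod n) ≠ 0 := neg_ne_zero.2 h10
  unfold nedP at h
  rw [← prod_sdiff (subset_univ ({0, -1, 1} : Finset (ZMod n))),
    ← prod_sdiff (subset_univ ({0, -1, 1} : Finset (ZMod n)))] at h
  have off_sites (i : ZMod n) (hi : i ∈ univ \ ({0, -1, 1} : Finset (ZMod n))) :
      nedQ n 2 p1 p2 (fun i => decide (i = 0)) i (decide (i = 1)) = 1 - p1 ∧
      nedQ n 2 p1 p2 (fun i => decide (i = 1)) i (decide (i = 0)) = 1 - p1 := by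
    simp only [mem_sdiff, mem_univ, true_and, mem_insert, mem_singleton, not_or] at hi
    obtain ⟨h0, hm, h1⟩ := hi
    have : i + 1 ≠ 0 := fun h => hm (eq_neg_of_add_eq_zero_left h)
    simp [nedQ_two, *]
  rw [prod_congr rfl fun i hi => (off_sites i hi).1,
    prod_congr rfl fun i hi => (off_sites i hi).2, prod_const] at h
  have hsites := mul_left_cancel₀ (pow_ne_zero _ (sub_pos.2 hp1).ne') h
  rw [prod_insert (by simp [h10.symm, hm0.symm]), prod_insert (by simp [hm1]), prod_singleton,
    prod_insert (by simp [h10.symm, hm0.symm]), prod_insert (by simp [hm1]), prod_singleton] at hsites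
  simp [nedQ_two, h10.symm, h20, hm1] at hsites
  linarith

/-- for `m = 2` and `p1, p2 ∈ (0,1)`, the 2-NED is reversible (detailed
balance holds for `π = W / Z_{n,2}`) if and only if `n = 2`, or `n > 2` and `p1 + p2 = 1`. -/
theorem ned2_reversible_iff (n : ℕ) [NeZero n] (hn : 2 ≤ n)
    (p1 p2 : ℝ) (hp1 : p1 ∈ Set.Ioo (0 : ℝ) 1) (hp2 : p2 ∈ Set.Ioo (0 : ℝ) 1) :
    (∀ α β : ZMod n → Bool,
        nedW n 2 p1 p2 α / nedZ n 2 p1 p2 * nedP n 2 p1 p2 α β =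
          nedW n 2 p1 p2 β / nedZ n 2 p1 p2 * nedP n 2 p1 p2 β α) ↔
      (n = 2 ∨ (2 < n ∧ p1 + p2 = 1)) := by
  have hZ := (nedZ_two_pos n hp1 hp2).ne'
  simp only [div_mul_eq_mul_div, div_left_inj' hZ]
  constructor
  · intro h
    rcases hn.eq_or_lt with h2 | h2
    · exact .inl h2.symm
    · refine .inr ⟨h2, add_eq_one_of_nedP_single n h2 hp1.2 ?_⟩
      have h01 := h (fun i => decide (i = 0)) (fun i => decide (i = 1))
      rw [nedW_two_single n hn p1 p2 1, ← nedW_two_single n hn p1 p2 0] at h01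
      exact mul_left_cancel₀ (nedW_two_pos n hp1 hp2 _).ne' h01
  · rintro (rfl | ⟨-, h⟩) α β
    · convert nedW_mul_nedP_two_sites hp2.1.ne' α β
    · exact nedW_mul_nedP_of_add_eq_one n hp2.1.ne' h α β
end

section
/- Define Z_0 = 2 and, for n ≥ 1, Z_n = 1 + ∑_{k=1}^{n} ∑_{j=0}^{n−k} (n/k)·C(k,j)·C(n−k−1, j−1)·p1^k·q2^j, where q2 = (1−p1)/p2 and C(−1,−1) = 1. Then Z_1 = 1 + p1, and the sequence (Z_n) satisfies the recurrence p1·(1 − p1 − p2)·Z_n + p2·(1 + p1)·Z_{n+1} = p2·Z_{n+2} for every n ≥ 2. -/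
open Finset

/-- The generating polynomial `∑ j, C(k,j) C(a,j) q^j`. -/
noncomputable def chooseMulSum (q : ℝ) (k a : ℕ) : ℝ :=
  ∑ j ∈ range (a + 1), (k.choose j : ℝ) * a.choose j * q ^ j

lemma sum_range_choose_mul_choose (q : ℝ) (k : ℕ) {a N : ℕ} (h : a < N) :
    ∑ j ∈ range N, (k.choose j : ℝ) * a.choose j * q ^ j = chooseMulSum q k a := by
  refine (sum_subset (range_mono h) fun j _ hj => ?_).symm
  rw [mem_range, not_lt] at hj
  simp [Nat.choose_eq_zero_of_lt (show a < j by omega)]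

@[simp]
lemma chooseMulSum_zero_left (q : ℝ) (a : ℕ) : chooseMulSum q 0 a = 1 := by
  simp [chooseMulSum, sum_range_succ']

@[simp]
lemma chooseMulSum_zero_right (q : ℝ) (k : ℕ) : chooseMulSum q k 0 = 1 := by
  simp [chooseMulSum]

lemma chooseMulSum_eq_one_add (q : ℝ) (k : ℕ) {a N : ℕ} (h : a ≤ N) :
    chooseMulSum q k a =
      1 + ∑ j ∈ range N, (k.choose (j + 1) : ℝ) * a.choose (j + 1) * q ^ (j + 1) := by
  rw [← sum_range_choose_mul_choose q k (Nat.lt_succ_of_le h), sum_range_succ']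
  simp [add_comm]

lemma chooseMulSum_succ_succ (q : ℝ) (k a : ℕ) :
    chooseMulSum q (k + 1) (a + 1) =
      chooseMulSum q (k + 1) a + chooseMulSum q k (a + 1) + (q - 1) * chooseMulSum q k a := by
  have key : ∑ j ∈ range (a + 1),
        ((k + 1).choose (j + 1) : ℝ) * (a + 1).choose (j + 1) * q ^ (j + 1) =
      ∑ j ∈ range (a + 1), ((k + 1).choose (j + 1) : ℝ) * a.choose (j + 1) * q ^ (j + 1)
        + ∑ j ∈ range (a + 1), (k.choose (j + 1) : ℝ) * (a + 1).choose (j + 1) * q ^ (j + 1)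
        + q * chooseMulSum q k a
        - ∑ j ∈ range (a + 1), (k.choose (j + 1) : ℝ) * a.choose (j + 1) * q ^ (j + 1) := by
    rw [chooseMulSum, mul_sum, ← sum_add_distrib, ← sum_add_distrib, ← sum_sub_distrib]
    refine sum_congr rfl fun j _ => ?_
    rw [Nat.choose_succ_succ' k, Nat.choose_succ_succ' a]
    push_cast
    ring
  have h₁ := chooseMulSum_eq_one_add q (k + 1) (le_refl (a + 1))
  have h₂ := chooseMulSum_eq_one_add q (k + 1) a.le_succ
  have h₃ := chooseMulSum_eq_one_add q k (le_refl (a + 1))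
  have h₄ := chooseMulSum_eq_one_add q k a.le_succ
  linear_combination h₁ + key - h₂ - h₃ + h₄

/-- The homogenisation `∑_{k+a=n} p^k ∑ j, C(k,j) C(a,j) q^j`. -/
noncomputable def antidiagonalChooseSum (p q : ℝ) (n : ℕ) : ℝ :=
  ∑ x ∈ antidiagonal n, p ^ x.1 * chooseMulSum q x.1 x.2

lemma antidiagonalChooseSum_succ_eq_one_add (p q : ℝ) (n : ℕ) :
    antidiagonalChooseSum p q (n + 1) =
      1 + ∑ x ∈ antidiagonal n, p ^ (x.1 + 1) * chooseMulSum q (x.1 + 1) x.2 := by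
  simp [antidiagonalChooseSum, Nat.sum_antidiagonal_succ]

lemma antidiagonalChooseSum_succ_eq_pow_add (p q : ℝ) (n : ℕ) :
    antidiagonalChooseSum p q (n + 1) =
      p ^ (n + 1) + ∑ x ∈ antidiagonal n, p ^ x.1 * chooseMulSum q x.1 (x.2 + 1) := by
  simp [antidiagonalChooseSum, Nat.sum_antidiagonal_succ']

lemma antidiagonalChooseSum_add_two_eq_one_add_pow_add (p q : ℝ) (n : ℕ) :
    antidiagonalChooseSum p q (n + 2) = 1 + p ^ (n + 2) +
      ∑ x ∈ antidiagonal n, p ^ (x.1 + 1) * chooseMulSum q (x.1 + 1) (x.2 + 1) := by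
  rw [antidiagonalChooseSum_succ_eq_one_add, Nat.sum_antidiagonal_succ']
  simp
  ring

lemma antidiagonalChooseSum_add_two (p q : ℝ) (n : ℕ) :
    antidiagonalChooseSum p q (n + 2) =
      (1 + p) * antidiagonalChooseSum p q (n + 1)
        + p * (q - 1) * antidiagonalChooseSum p q n := by
  have key : ∑ x ∈ antidiagonal n, p ^ (x.1 + 1) * chooseMulSum q (x.1 + 1) (x.2 + 1) =
      ∑ x ∈ antidiagonal n, p ^ (x.1 + 1) * chooseMulSum q (x.1 + 1) x.2
        + p * ∑ x ∈ antidiagonal n, p ^ x.1 * chooseMulSum q x.1 (x.2 + 1)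
        + p * (q - 1) * antidiagonalChooseSum p q n := by
    rw [antidiagonalChooseSum, mul_sum, mul_sum, ← sum_add_distrib, ← sum_add_distrib]
    refine sum_congr rfl fun x _ => ?_
    rw [chooseMulSum_succ_succ]
    ring
  have h := antidiagonalChooseSum_add_two_eq_one_add_pow_add p q n
  have h₁ := antidiagonalChooseSum_succ_eq_one_add p q n
  have h₂ := antidiagonalChooseSum_succ_eq_pow_add p q n
  linear_combination h + key - h₁ - p * h₂

lemma ichoose_neg_one_right (a : ℕ) : ichoose a (-1) = 0 := by
  simp [ichoose]

lemma ichoose_natCast (a b : ℕ) : ichoose a b = a.choose b := by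
  simp [ichoose]

lemma add_div_mul_choose_mul_choose (k a j : ℕ) :
    ((k + 1 + (a + 1) : ℕ) : ℝ) / (k + 1 : ℕ) * (k + 1).choose (j + 1) * a.choose j =
      2 * ((k + 1).choose (j + 1) * (a + 1).choose (j + 1))
        - k.choose (j + 1) * (a + 1).choose (j + 1)
        - (k + 1).choose (j + 1) * a.choose (j + 1) := by
  have hk : ((k + 1 : ℕ) : ℝ) * k.choose j = (k + 1).choose (j + 1) * (j + 1 : ℕ) := by
    exact_mod_cast Nat.add_one_mul_choose_eq k j
  have ha : ((a + 1 : ℕ) : ℝ) * a.choose j = (a + 1).choose (j + 1) * (j + 1 : ℕ) := by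
    exact_mod_cast Nat.add_one_mul_choose_eq a j
  have hk' : ((k + 1).choose (j + 1) : ℝ) = k.choose j + k.choose (j + 1) := by
    exact_mod_cast Nat.choose_succ_succ k j
  have ha' : ((a + 1).choose (j + 1) : ℝ) = a.choose j + a.choose (j + 1) := by
    exact_mod_cast Nat.choose_succ_succ a j
  have h0 : ((k + 1 : ℕ) : ℝ) ≠ 0 := by positivity
  have hR : 2 * ((k + 1).choose (j + 1) * (a + 1).choose (j + 1) : ℝ)
        - k.choose (j + 1) * (a + 1).choose (j + 1)
        - (k + 1).choose (j + 1) * a.choose (j + 1) =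
      k.choose j * (a + 1).choose (j + 1) + (k + 1).choose (j + 1) * a.choose j := by
    linear_combination ((a + 1).choose (j + 1) : ℝ) * hk' + ((k + 1).choose (j + 1) : ℝ) * ha'
  rw [hR]
  field_simp
  rw [Nat.cast_add]
  linear_combination ((k + 1).choose (j + 1) : ℝ) * ha - ((a + 1).choose (j + 1) : ℝ) * hk

/-- The coefficient of `p1 ^ k` in `Zseq`, with `a = n - k`. -/
noncomputable def zseqCoeff (q : ℝ) (k a : ℕ) : ℝ :=
  ∑ j ∈ range (a + 1), ((k + a : ℕ) : ℝ) / k * (k.choose j : ℝ) *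
    (ichoose ((a : ℤ) - 1) ((j : ℤ) - 1) : ℝ) * q ^ j

lemma zseqCoeff_succ_zero (q : ℝ) (k : ℕ) : zseqCoeff q (k + 1) 0 = 1 := by
  have h0 : (k : ℝ) + 1 ≠ 0 := by positivity
  simp [zseqCoeff, ichoose, h0]

lemma zseqCoeff_succ_succ (q : ℝ) (k a : ℕ) :
    zseqCoeff q (k + 1) (a + 1) = 2 * chooseMulSum q (k + 1) (a + 1)
      - chooseMulSum q k (a + 1) - chooseMulSum q (k + 1) a := by
  rw [← sum_range_choose_mul_choose q (k + 1) (show a < a + 2 by omega), chooseMulSum,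
    chooseMulSum, zseqCoeff, mul_sum, ← sum_sub_distrib, ← sum_sub_distrib]
  refine sum_congr rfl fun j _ => ?_
  rcases j with _ | j
  · simp [ichoose_neg_one_right]
    ring
  · rw [show ((a + 1 : ℕ) : ℤ) - 1 = (a : ℕ) by push_cast; ring,
      show ((j + 1 : ℕ) : ℤ) - 1 = (j : ℕ) by push_cast; ring, ichoose_natCast,
      add_div_mul_choose_mul_choose]
    ring

lemma Zseq_succ (p1 p2 : ℝ) (n : ℕ) :
    Zseq p1 p2 (n + 1) =
      1 + ∑ x ∈ antidiagonal n, p1 ^ (x.1 + 1) * zseqCoeff ((1 - p1) / p2) (x.1 + 1) x.2 := by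
  rw [Zseq, if_neg n.succ_ne_zero, Nat.sum_antidiagonal_eq_sum_range_succ_mk,
    ← Ico_add_one_right_eq_Icc, sum_Ico_eq_sum_range]
  refine congrArg (1 + ·) (sum_congr rfl fun k hk => ?_)
  obtain ⟨a, rfl⟩ := Nat.exists_eq_add_of_le (Nat.lt_succ_iff.mp (mem_range.mp hk))
  have h₁ : k + a + 1 - (1 + k) = a := by omega
  have h₂ : ((k + a + 1 : ℕ) : ℤ) - (1 + k : ℕ) - 1 = a - 1 := by push_cast; ring
  simp only [h₁, h₂, Nat.add_sub_cancel_left, zseqCoeff, mul_sum]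
  refine sum_congr rfl fun j _ => ?_
  rw [add_comm 1 k, add_right_comm k a 1]
  ring

lemma Zseq_add_two (p1 p2 : ℝ) (n : ℕ) :
    Zseq p1 p2 (n + 2) = 2 * antidiagonalChooseSum p1 ((1 - p1) / p2) (n + 2)
      - (1 + p1) * antidiagonalChooseSum p1 ((1 - p1) / p2) (n + 1) := by
  set q := (1 - p1) / p2 with hq
  have h₁ := antidiagonalChooseSum_succ_eq_one_add p1 q n
  have h₂ := antidiagonalChooseSum_succ_eq_pow_add p1 q n
  have h := antidiagonalChooseSum_add_two_eq_one_add_pow_add p1 q n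
  have key : ∑ x ∈ antidiagonal n, p1 ^ (x.1 + 1) * zseqCoeff q (x.1 + 1) (x.2 + 1) =
      2 * ∑ x ∈ antidiagonal n, p1 ^ (x.1 + 1) * chooseMulSum q (x.1 + 1) (x.2 + 1)
        - p1 * ∑ x ∈ antidiagonal n, p1 ^ x.1 * chooseMulSum q x.1 (x.2 + 1)
        - ∑ x ∈ antidiagonal n, p1 ^ (x.1 + 1) * chooseMulSum q (x.1 + 1) x.2 := by
    rw [mul_sum, mul_sum, ← sum_sub_distrib, ← sum_sub_distrib]
    refine sum_congr rfl fun x _ => ?_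
    rw [zseqCoeff_succ_succ]
    ring
  rw [Zseq_succ, ← hq, Nat.sum_antidiagonal_succ', zseqCoeff_succ_zero]
  linear_combination key - 2 * h + p1 * h₂ + h₁

/-- `Z_1 = 1 + p1` and the recurrence
`p1(1 - p1 - p2) Z_n + p2(1 + p1) Z_{n+1} = p2 Z_{n+2}` for all `n ≥ 2`. -/
theorem ned2_partition_recurrence (p1 p2 : ℝ)
    (hp1 : p1 ∈ Set.Ioo (0 : ℝ) 1) (hp2 : p2 ∈ Set.Ioc (0 : ℝ) 1) :
    Zseq p1 p2 1 = 1 + p1 ∧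
      ∀ n : ℕ, 2 ≤ n →
        p1 * (1 - p1 - p2) * Zseq p1 p2 n + p2 * (1 + p1) * Zseq p1 p2 (n + 1) =
          p2 * Zseq p1 p2 (n + 2) := by
  refine ⟨by simp [Zseq, ichoose], fun n hn => ?_⟩
  obtain ⟨m, rfl⟩ := Nat.exists_eq_add_of_le' hn
  have hp2_ne : p2 ≠ 0 := hp2.1.ne'
  have hq : p2 * ((1 - p1) / p2) = 1 - p1 := mul_div_cancel₀ _ hp2_ne
  rw [show m + 2 + 1 = (m + 1) + 2 from rfl, Zseq_add_two, Zseq_add_two, Zseq_add_two]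
  have h₁ := antidiagonalChooseSum_add_two p1 ((1 - p1) / p2) (m + 1)
  have h₂ := antidiagonalChooseSum_add_two p1 ((1 - p1) / p2) (m + 2)
  set q := (1 - p1) / p2
  set U := antidiagonalChooseSum p1 q
  linear_combination (1 + p1) * p2 * h₁ - 2 * p2 * h₂
    - p1 * (2 * U (m + 2) - (1 + p1) * U (m + 1)) * hq
end

section
/- Suppose p1 ∈ (0,1), p2 ∈ (0,1] and p1 + p2 ≠ 1. Then the free energy of the 2-NED exists and equals F(2, p1, p2) = lim_{n→∞} (1/n)·log Z_{n,2} = −log( (−p2(1+p1) + √(p2·(1−p1)·(4p1 + p2 − p1·p2)))/(2·p1·(1 − p1 − p2)) ). -/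
open Finset

/-- Summing a product of matrix entries over all paths with `n` steps gives the entries of the
`n`-th power. -/
theorem sum_path_prod_eq_sum_pow {ι R : Type*} [Fintype ι] [DecidableEq ι] [CommSemiring R]
    (T : Matrix ι ι R) (n : ℕ) (f : ι → ι → R) :
    ∑ β : Fin (n + 1) → ι,
        (∏ i : Fin n, T (β i.castSucc) (β i.succ)) * f (β 0) (β (Fin.last n)) =
      ∑ a, ∑ b, (T ^ n) a b * f a b := by
  induction n generalizing f with
  | zero =>
    rw [← (Equiv.funUnique (Fin 1) ι).symm.sum_comp]
    simp [Matrix.one_apply]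
  | succ n ih =>
    rw [← (Fin.consEquiv fun _ : Fin (n + 2) => ι).sum_comp, Fintype.sum_prod_type]
    refine Finset.sum_congr rfl fun a _ => ?_
    have key := ih fun c b => T a c * f a b
    simp only [Fin.consEquiv_apply, Fin.prod_univ_succ, Fin.castSucc_zero, Fin.cons_zero,
      Fin.cons_succ, ← Fin.succ_castSucc, ← Fin.succ_last]
    calc _ = ∑ β : Fin (n + 1) → ι, (∏ i : Fin n, T (β i.castSucc) (β i.succ)) *
          (T a (β 0) * f a (β (Fin.last n))) :=
          Finset.sum_congr rfl fun β _ => by ring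
      _ = _ := by
        rw [key, Finset.sum_comm]
        refine Finset.sum_congr rfl fun b _ => ?_
        rw [pow_succ', Matrix.mul_apply, Finset.sum_mul]
        exact Finset.sum_congr rfl fun c _ => by ring

/-- The transfer-matrix formula: closed paths of length `n` on the ring sum to `tr (T ^ n)`. -/
theorem sum_ring_prod_eq_trace_pow {ι R : Type*} [Fintype ι] [DecidableEq ι] [CommSemiring R]
    (T : Matrix ι ι R) (n : ℕ) [NeZero n] :
    ∑ β : ZMod n → ι, ∏ i : ZMod n, T (β i) (β (i + 1)) = (T ^ n).trace := by
  obtain _ | n := n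
  · exact absurd rfl (NeZero.ne 0)
  · change ∑ β : Fin (n + 1) → ι, ∏ i : Fin (n + 1), T (β i) (β (i + 1)) = _
    simp only [Fin.prod_univ_castSucc, Fin.coeSucc_eq_succ, Fin.last_add_one]
    rw [sum_path_prod_eq_sum_pow T n fun a b => T b a]
    simp [Matrix.trace, pow_succ, Matrix.mul_apply]

theorem det_matrix_bool {R : Type*} [CommRing R] (T : Matrix Bool Bool R) :
    T.det = T true true * T false false - T true false * T false true := by
  rw [← Matrix.det_reindex_self finTwoEquiv.symm, Matrix.det_fin_two]
  simp [finTwoEquiv]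
  ring

/-- Power sums of the eigenvalues of a `2 × 2` matrix are the traces of its powers. -/
theorem trace_pow_eq_add_pow {R : Type*} [CommRing R] (T : Matrix Bool Bool R) (x y : R)
    (hadd : T.trace = x + y) (hmul : T.det = x * y) (n : ℕ) :
    (T ^ n).trace = x ^ n + y ^ n := by
  have htrace : T.trace = T true true + T false false := by simp [Matrix.trace]
  rw [htrace] at hadd
  rw [det_matrix_bool] at hmul
  have hsq : T ^ 2 = (x + y) • T - (x * y) • (1 : Matrix Bool Bool R) := by
    rw [← hadd, ← hmul]
    ext a b
    cases a <;> cases b <;> simp [sq, Matrix.mul_apply] <;> ring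
  induction n using Nat.twoStepInduction with
  | zero => simp [one_add_one_eq_two]
  | one => simp [htrace, hadd]
  | more n ih0 ih1 =>
    have hrec : T ^ (n + 2) = (x + y) • T ^ (n + 1) - (x * y) • T ^ n := by
      rw [pow_add, hsq, mul_sub, Matrix.mul_smul, Matrix.mul_smul, mul_one, ← pow_succ]
    rw [hrec, Matrix.trace_sub, Matrix.trace_smul, Matrix.trace_smul, ih0, ih1]
    simp only [smul_eq_mul]
    ring

/-- The transfer matrix of the 2-NED with site weight `p` and `01`-weight `q`. -/
def ned2Transfer (p q : ℝ) : Matrix Bool Bool ℝ := fun a b =>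
  (if a = true then p else 1) * (if a = false ∧ b = true then q else 1)

theorem Zpart2_eq_trace_pow (p1 p2 : ℝ) {n : ℕ} (hn : n ≠ 0) :
    Zpart2 p1 p2 n = (ned2Transfer p1 ((1 - p1) / p2) ^ n).trace := by
  have : NeZero n := ⟨hn⟩
  rw [← sum_ring_prod_eq_trace_pow, Zpart2, dif_neg hn]
  refine Finset.sum_congr rfl fun β _ => ?_
  simp only [ned2Transfer, Finset.prod_mul_distrib]
  simp [nedN1, nedN0r1, Finset.prod_ite, div_pow]

theorem Zpart2_eq_add_pow {p1 p2 x y : ℝ} (hadd : x + y = 1 + p1)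
    (hmul : x * y = p1 * (1 - (1 - p1) / p2)) {n : ℕ} (hn : n ≠ 0) :
    Zpart2 p1 p2 n = x ^ n + y ^ n := by
  rw [Zpart2_eq_trace_pow p1 p2 hn]
  refine trace_pow_eq_add_pow _ x y ?_ ?_ n
  · simp [hadd, Matrix.trace, ned2Transfer, add_comm]
  · rw [hmul, det_matrix_bool]
    simp [ned2Transfer]
    ring

theorem tendsto_log_add_pow {x y : ℝ} (hx : 0 < x) (hyx : |y| < x) :
    Filter.Tendsto (fun n : ℕ => 1 / (n : ℝ) * Real.log (x ^ n + y ^ n)) Filter.atTop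
      (nhds (Real.log x)) := by
  have hr : |y / x| < 1 := by rwa [abs_div, abs_of_pos hx, div_lt_one hx]
  have hpow : Filter.Tendsto (fun n : ℕ => 1 + (y / x) ^ n) Filter.atTop (nhds 1) := by
    simpa using (tendsto_pow_atTop_nhds_zero_of_abs_lt_one hr).const_add 1
  have hlog := hpow.log one_ne_zero
  have hlim := ((tendsto_one_div_atTop_nhds_zero_nat (𝕜 := ℝ)).mul hlog).const_add (Real.log x)
  rw [zero_mul, add_zero] at hlim
  refine hlim.congr' ?_
  filter_upwards [Filter.eventually_ne_atTop 0, hpow.eventually_ne one_ne_zero] with n hn hne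
  have hfactor : x ^ n + y ^ n = x ^ n * (1 + (y / x) ^ n) := by
    rw [div_pow]
    field_simp
  rw [hfactor, Real.log_mul (pow_pos hx n).ne' hne, Real.log_pow]
  field_simp

/-- for `p1 ∈ (0,1)`, `p2 ∈ (0,1]` with `p1 + p2 ≠ 1`, the free energy of
the 2-NED exists and equals
`-log((-p2(1+p1) + √(p2(1-p1)(4p1 + p2 - p1 p2))) / (2 p1 (1 - p1 - p2)))`. -/
theorem ned2_free_energy (p1 p2 : ℝ)
    (hp1 : p1 ∈ Set.Ioo (0 : ℝ) 1) (hp2 : p2 ∈ Set.Ioc (0 : ℝ) 1) (h : p1 + p2 ≠ 1) :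
    Filter.Tendsto (fun n : ℕ => 1 / (n : ℝ) * Real.log (Zpart2 p1 p2 n)) Filter.atTop
      (nhds (- Real.log
        ((-p2 * (1 + p1) + Real.sqrt (p2 * (1 - p1) * (4 * p1 + p2 - p1 * p2))) /
          (2 * p1 * (1 - p1 - p2))))) := by
  obtain ⟨hp1, hp1'⟩ := hp1
  have hp2 := hp2.1
  have hq : 0 < (1 - p1) / p2 := div_pos (by linarith) hp2
  have hD : 0 < (1 - p1) ^ 2 + 4 * p1 * ((1 - p1) / p2) := by positivity
  set s := √((1 - p1) ^ 2 + 4 * p1 * ((1 - p1) / p2))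
  have hs0 : 0 < s := Real.sqrt_pos.2 hD
  have hs2 : s ^ 2 = (1 - p1) ^ 2 + 4 * p1 * ((1 - p1) / p2) := Real.sq_sqrt hD.le
  have hx : 0 < (1 + p1 + s) / 2 := by positivity
  have hyx : |(1 + p1 - s) / 2| < (1 + p1 + s) / 2 := abs_lt.2 ⟨by linarith, by linarith⟩
  have hsqrt : √(p2 * (1 - p1) * (4 * p1 + p2 - p1 * p2)) = p2 * s := by
    rw [← Real.sqrt_sq (by positivity : 0 ≤ p2 * s), mul_pow, hs2]
    congr 1
    field_simp
    ring
  have hne : 1 - p1 - p2 ≠ 0 := fun h' => h (by linarith)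
  have hinv : (-p2 * (1 + p1) + p2 * s) / (2 * p1 * (1 - p1 - p2)) = ((1 + p1 + s) / 2)⁻¹ := by
    have hs2' : p2 * s ^ 2 = p2 * (1 - p1) ^ 2 + 4 * p1 * (1 - p1) := by
      rw [hs2]
      field_simp
    rw [← one_div, div_eq_div_iff (by positivity) hx.ne']
    linear_combination hs2' / 2
  rw [hsqrt, hinv, Real.log_inv, neg_neg]
  refine (tendsto_log_add_pow hx hyx).congr' ?_
  filter_upwards [Filter.eventually_ne_atTop 0] with n hn
  rw [Zpart2_eq_add_pow (x := (1 + p1 + s) / 2) (y := (1 + p1 - s) / 2) (by ring)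
    (by linear_combination -hs2 / 4) hn]
end

section
/- For every configuration α ∈ Ω, the transition probability of the m-NED into the all-zero configuration 0^n is given by P(α → 0^n) = (1−p1)^{n − N1(α) − ∑_{s=1}^{m−2} s·N_{10^s1}(α) − (m−1)·N_{0^{m−1}1}(α)} · p2^{N_{0^{m−1}1}(α)}. In particular P(0^n → 0^n) = (1−p1)^n. -/
open Finset

/-- The number of sites `i` at which `r` consecutive zeros begin. -/
def nedN0r (n : ℕ) [NeZero n] (r : ℕ) (β : ZMod n → Bool) : ℕ :=
  (univ.filter fun i : ZMod n => ∀ j : Fin r, β (i + (j.val : ZMod n)) = false).card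

lemma nedN0r1_zero (n : ℕ) [NeZero n] (β : ZMod n → Bool) : nedN0r1 n 0 β = nedN1 n β := by
  simp [nedN0r1, nedN1]

lemma nedN0r_succ_add (n : ℕ) [NeZero n] (r : ℕ) (β : ZMod n → Bool) :
    nedN0r n (r + 1) β + nedN0r1 n r β = nedN0r n r β := by
  unfold nedN0r nedN0r1
  rw [← card_filter_add_card_filter_not (s := univ.filter fun i : ZMod n =>
    ∀ j : Fin r, β (i + (j.val : ZMod n)) = false) (fun i => β (i + (r : ZMod n)) = false)]
  simp only [filter_filter, Fin.forall_fin_succ', Fin.val_castSucc, Fin.val_last,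
    Bool.not_eq_false]

lemma nedN0r_add_sum (n : ℕ) [NeZero n] (r : ℕ) (β : ZMod n → Bool) :
    nedN0r n r β + ∑ d ∈ range r, nedN0r1 n d β = n := by
  induction r with
  | zero => simp [nedN0r, ZMod.card]
  | succ r ih =>
    have := nedN0r_succ_add n r β
    rw [sum_range_succ]
    omega

lemma nedN0r1_eq_add (n : ℕ) [NeZero n] (r : ℕ) (β : ZMod n → Bool) :
    nedN0r1 n r β = nedN10r1 n r β + nedN0r1 n (r + 1) β := by
  have shift : nedN0r1 n r β = (univ.filter fun i : ZMod n =>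
      (∀ j : Fin r, β (i + ((j.val + 1 : ℕ) : ZMod n)) = false) ∧
        β (i + ((r + 1 : ℕ) : ZMod n)) = true).card := by
    unfold nedN0r1
    refine (card_equiv (Equiv.addRight (1 : ZMod n)) fun i => ?_).symm
    simp [add_assoc, add_comm (1 : ZMod n)]
  rw [shift, ← card_filter_add_card_filter_not (fun i : ZMod n => β i = true)]
  unfold nedN10r1 nedN0r1
  simp only [filter_filter, Fin.forall_fin_succ, Fin.val_zero, Fin.val_succ, Nat.cast_zero,
    add_zero, Bool.not_eq_true]
  congr 2 <;> · ext i; simp only [mem_filter]; tauto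

lemma sum_range_nedN0r1 (n : ℕ) [NeZero n] (r : ℕ) (β : ZMod n → Bool) :
    ∑ d ∈ range (r + 2), nedN0r1 n d β =
      nedN1 n β + ∑ s ∈ Icc 1 r, s * nedN10r1 n s β + (r + 1) * nedN0r1 n (r + 1) β := by
  induction r with
  | zero => simp [sum_range_succ, nedN0r1_zero]
  | succ r ih =>
    rw [sum_range_succ, ih, sum_Icc_succ_top (by omega), nedN0r1_eq_add n (r + 1) β]
    ring

lemma nedP_zero_right (n r : ℕ) [NeZero n] (p1 p2 : ℝ) (α : ZMod n → Bool) :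
    nedP n (r + 1) p1 p2 α (fun _ => false) =
      (1 - p1) ^ nedN0r n (r + 1) α * p2 ^ nedN0r1 n r α := by
  unfold nedP nedN0r nedN0r1
  rw [← prod_const, ← prod_const, prod_filter, prod_filter, ← prod_mul_distrib]
  refine prod_congr rfl fun i _ => ?_
  simp only [nedQ, Nat.add_sub_cancel, Fin.forall_fin_succ', Fin.val_castSucc, Fin.val_last]
  cases α (i + (r : ZMod n)) <;> simp

/-- the transition probability into the all-zero configuration:
`P(α → 0^n) = (1-p1)^{n - N₁(α) - ∑_{s=1}^{m-2} s N_{10^s1}(α) - (m-1) N_{0^{m-1}1}(α)}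
· p2^{N_{0^{m-1}1}(α)}`; in particular `P(0^n → 0^n) = (1-p1)^n`. -/
theorem ned_transition_to_zero (n m : ℕ) [NeZero n] (hm : 2 ≤ m) (hmn : m ≤ n)
    (p1 p2 : ℝ) (hp1 : p1 ∈ Set.Ioo (0 : ℝ) 1) (hp2 : p2 ∈ Set.Ioc (0 : ℝ) 1)
    (α : ZMod n → Bool) :
    nedP n m p1 p2 α (fun _ => false) =
        (1 - p1) ^ (n - nedN1 n α - (∑ s ∈ Finset.Icc 1 (m - 2), s * nedN10r1 n s α) -
          (m - 1) * nedN0r1 n (m - 1) α) * p2 ^ nedN0r1 n (m - 1) α ∧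
      nedP n m p1 p2 (fun _ => false) (fun _ => false) = (1 - p1) ^ n := by
  obtain ⟨r, rfl⟩ := Nat.exists_eq_add_of_le' hm
  refine ⟨?_, by simp [nedP, nedQ, ZMod.card]⟩
  have hsum : nedN0r n (r + 1 + 1) α + _ = n := nedN0r_add_sum n (r + 2) α
  rw [sum_range_nedN0r1] at hsum
  simp only [nedP_zero_right, Nat.add_sub_cancel, show r + 2 - 1 = r + 1 from rfl]
  congr 2
  omega
end
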